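/- arXiv:2511.18064 — 3 statements merged into one kernel-verified Lean document; each statement's English description precedes it below -/
import Mathlib

section
/- Let G be an infinite commutative group and (Bᵢ) a sequence of finite nonempty subsets of G such that for every t ∈ G, |(Bᵢ + t) \ Bᵢ| / |Bᵢ| → 0 as i → ∞. Then for every bounded f : G → ℝ, sup_{t∈G} (f|Bᵢ)(t) → M*(f) as i → ∞. Moreover, condition |(Bᵢ + t) \ Bᵢ| / |Bᵢ| → 0 for all t is necessary for this conclusion, and a sequence with this property exists if and only if G is countable. -/
open scoped Pointwise BigOperators
open Filter

/-- A real function on `G` is bounded. -/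
def Bounded {G : Type*} (f : G → ℝ) : Prop :=
  ∃ C : ℝ, ∀ x, |f x| ≤ C

/-- An upper mean on the bounded real functions on a commutative group `G`. -/
structure IsUpperMean (G : Type*) [AddCommGroup G] (M : (G → ℝ) → ℝ) : Prop where
  norming : ∀ c : ℝ, M (fun _ => c) = c
  mono : ∀ f g : G → ℝ, Bounded f → Bounded g → (∀ x, f x ≤ g x) → M f ≤ M g
  homog : ∀ c : ℝ, 0 ≤ c → ∀ f : G → ℝ, Bounded f → M (fun x => c * f x) = c * M f
  restr_add : ∀ f : G → ℝ, Bounded f → ∀ t : G, M (fun x => f x + f (x + t)) = 2 * M f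
  subadd : ∀ f g : G → ℝ, Bounded f → Bounded g → M (fun x => f x + g x) ≤ M f + M g

/-- A lower mean on the bounded real functions on a commutative group `G`. -/
structure IsLowerMean (G : Type*) [AddCommGroup G] (M : (G → ℝ) → ℝ) : Prop where
  norming : ∀ c : ℝ, M (fun _ => c) = c
  mono : ∀ f g : G → ℝ, Bounded f → Bounded g → (∀ x, f x ≤ g x) → M f ≤ M g
  homog : ∀ c : ℝ, 0 ≤ c → ∀ f : G → ℝ, Bounded f → M (fun x => c * f x) = c * M f
  restr_add : ∀ f : G → ℝ, Bounded f → ∀ t : G, M (fun x => f x + f (x + t)) = 2 * M f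
  superadd : ∀ f g : G → ℝ, Bounded f → Bounded g → M f + M g ≤ M (fun x => f x + g x)

/-- `f` and `f'` are commarginal: marginals of a bounded `F` supported near the diagonal. -/
def Commarginal {G : Type*} [AddCommGroup G] (f f' : G → ℝ) : Prop :=
  ∃ (F : G → G → ℝ) (B : Finset G),
    (∃ C : ℝ, ∀ x y, |F x y| ≤ C) ∧
    (∀ x y, F x y ≠ 0 → x - y ∈ B) ∧
    (∀ x, ∑ᶠ y, F x y = f x) ∧
    (∀ y, ∑ᶠ x, F x y = f' y)

/-- Uniform convergence of a sequence of functions. -/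
def UnifLim {G : Type*} (g : ℕ → G → ℝ) (f : G → ℝ) : Prop :=
  ∀ ε : ℝ, 0 < ε → ∃ N : ℕ, ∀ n ≥ N, ∀ x, |g n x - f x| < ε

/-- `f` and `f'` are limit-commarginal. -/
def LimitCommarginal {G : Type*} [AddCommGroup G] (f f' : G → ℝ) : Prop :=
  ∃ g g' : ℕ → G → ℝ, (∀ n, Bounded (g n)) ∧ (∀ n, Bounded (g' n)) ∧
    (∀ n, Commarginal (g n) (g' n)) ∧ UnifLim g f ∧ UnifLim g' f'

/-- `g` is a finite convex combination of translates of `f`. -/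
def ConvexCombTranslates {G : Type*} [AddCommGroup G] (f g : G → ℝ) : Prop :=
  ∃ (n : ℕ) (c : Fin n → ℝ) (t : Fin n → G),
    (∀ i, 0 ≤ c i) ∧ (∑ i, c i) = 1 ∧ ∀ x, g x = ∑ i, c i * f (x + t i)

/-- The uppermost mean `M*`. -/
noncomputable def Mstar {G : Type*} [AddCommGroup G] (f : G → ℝ) : ℝ :=
  sInf {a : ℝ | ∃ g : G → ℝ, ConvexCombTranslates f g ∧ a = sSup (Set.range g)}

/-- The lowest mean `M_*`. -/
noncomputable def Mlowstar {G : Type*} [AddCommGroup G] (f : G → ℝ) : ℝ :=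
  sSup {a : ℝ | ∃ g : G → ℝ, ConvexCombTranslates f g ∧ a = sInf (Set.range g)}

/-- The `B`-average `(f|B)(t)` of `f`. -/
noncomputable def avg {G : Type*} [AddCommGroup G] (f : G → ℝ) (B : Finset G) (t : G) : ℝ :=
  (∑ b ∈ B, f (b + t)) / (B.card : ℝ)

/-- The expansion pseudomean `E(f)`. -/
noncomputable def Epm {G : Type*} [AddCommGroup G] [DecidableEq G] (f : G → ℝ) : ℝ :=
  ⨅ T : {T : Finset G // T.Nonempty}, ⨆ B : {B : Finset G // B.Nonempty},
    (∑ b ∈ B.1, f b) / (((B.1 + T.1).card : ℝ))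

/-- A finite nonempty `Y ⊆ G` is a tile: some set `Z` of translates partitions `G`. -/
def IsTile {G : Type*} [AddCommGroup G] (Y : Finset G) : Prop :=
  Y.Nonempty ∧ ∃ Z : Set G, ∀ x : G, ∃! p : Y × Z, (p.1 : G) + (p.2 : G) = x

section UppermostMean

variable {G : Type*}

lemma Bounded.sub {f g : G → ℝ} (hf : Bounded f) (hg : Bounded g) :
    Bounded fun x => f x - g x := by
  obtain ⟨C, hC⟩ := hf
  obtain ⟨D, hD⟩ := hg
  exact ⟨C + D, fun x => (abs_sub _ _).trans (add_le_add (hC x) (hD x))⟩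

lemma Bounded.bddAbove_range {f : G → ℝ} (hf : Bounded f) : BddAbove (Set.range f) := by
  obtain ⟨C, hC⟩ := hf
  exact ⟨C, by rintro _ ⟨x, rfl⟩; exact (abs_le.1 (hC x)).2⟩

variable [AddCommGroup G]

lemma ConvexCombTranslates.abs_le {f g : G → ℝ} (h : ConvexCombTranslates f g) {C : ℝ}
    (hC : ∀ x, |f x| ≤ C) (x : G) : |g x| ≤ C := by
  obtain ⟨n, c, t, hc, hsum, hg⟩ := h
  calc |g x| ≤ ∑ i, |c i * f (x + t i)| := by rw [hg]; exact Finset.abs_sum_le_sum_abs _ _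
    _ ≤ ∑ i, c i * C := Finset.sum_le_sum fun i _ => by
        rw [abs_mul, abs_of_nonneg (hc i)]
        exact mul_le_mul_of_nonneg_left (hC _) (hc i)
    _ = C := by rw [← Finset.sum_mul, hsum, one_mul]

lemma ConvexCombTranslates.bounded {f g : G → ℝ} (h : ConvexCombTranslates f g)
    (hf : Bounded f) : Bounded g := by
  obtain ⟨C, hC⟩ := hf
  exact ⟨C, h.abs_le hC⟩

lemma convexCombTranslates_self (f : G → ℝ) : ConvexCombTranslates f f :=
  ⟨1, fun _ => 1, fun _ => 0, fun _ => zero_le_one, by simp, by simp⟩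

lemma convexCombTranslates_avg (f : G → ℝ) {B : Finset G} (hB : B.Nonempty) :
    ConvexCombTranslates f (avg f B) := by
  have hcard : (B.card : ℝ) ≠ 0 := by exact_mod_cast hB.card_pos.ne'
  refine ⟨B.card, fun _ => (B.card : ℝ)⁻¹, fun i => (B.equivFin.symm i : G),
    fun _ => by positivity, by simp [hcard], fun x => ?_⟩
  rw [avg, ← Finset.mul_sum, div_eq_inv_mul]
  congr 1
  rw [B.equivFin.symm.sum_comp (fun b : B => f (x + b)), Finset.sum_coe_sort B fun b => f (x + b)]
  exact Finset.sum_congr rfl fun b _ => by rw [add_comm]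

lemma Mstar_le_of_convexCombTranslates {f g : G → ℝ} (hf : Bounded f)
    (h : ConvexCombTranslates f g) : Mstar f ≤ sSup (Set.range g) := by
  obtain ⟨C, hC⟩ := hf
  refine csInf_le ⟨-C, ?_⟩ ⟨g, h, rfl⟩
  rintro _ ⟨g', hg', rfl⟩
  exact (abs_le.1 (hg'.abs_le hC 0)).1.trans
    (le_csSup (hg'.bounded ⟨C, hC⟩).bddAbove_range ⟨0, rfl⟩)

lemma exists_convexCombTranslates_lt (f : G → ℝ) {a : ℝ} (ha : Mstar f < a) :
    ∃ g, ConvexCombTranslates f g ∧ sSup (Set.range g) < a := by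
  obtain ⟨_, ⟨g, hg, rfl⟩, hlt⟩ :=
    exists_lt_of_csInf_lt (by exact ⟨_, f, convexCombTranslates_self f, rfl⟩) ha
  exact ⟨g, hg, hlt⟩

/-- A function of the form `h x - h (x - t)` has nonpositive uppermost mean. -/
lemma Mstar_sub_translate_nonpos {h : G → ℝ} (hh : Bounded h) (t : G) :
    Mstar (fun x => h x - h (x - t)) ≤ 0 := by
  obtain ⟨C, hC⟩ := hh
  have hf : Bounded fun x => h x - h (x - t) :=
    Bounded.sub ⟨C, hC⟩ ⟨C, fun x => hC _⟩
  have key : ∀ n : ℕ, Mstar (fun x => h x - h (x - t)) ≤ 2 * C / ((n : ℝ) + 1) := fun n => by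
    have hn : (n : ℝ) + 1 ≠ 0 := by positivity
    refine (Mstar_le_of_convexCombTranslates
      (g := fun x => ((n : ℝ) + 1)⁻¹ * (h (x + n • t) - h (x - t))) hf
      ⟨n + 1, fun _ => ((n : ℝ) + 1)⁻¹, fun i => (i : ℕ) • t, fun _ => by positivity,
        by simp [hn], fun x => ?_⟩).trans ?_
    · rw [← Finset.mul_sum]
      rw [Fin.sum_univ_eq_sum_range
        (fun i : ℕ => h (x + i • t) - h (x + i • t - t)) (n + 1)]
      have := Finset.sum_range_sub (fun i : ℕ => h (x + i • t - t)) (n + 1)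
      simp only [zero_smul, add_zero, succ_nsmul, ← add_assoc, add_sub_cancel_right] at this
      exact congrArg _ this.symm
    · refine csSup_le (Set.range_nonempty _) ?_
      rintro _ ⟨x, rfl⟩
      rw [div_eq_inv_mul]
      refine mul_le_mul_of_nonneg_left ?_ (by positivity)
      linarith [(abs_le.1 (hC (x + n • t))).2, (abs_le.1 (hC (x - t))).1]
  have hlim := (tendsto_one_div_add_atTop_nhds_zero_nat (𝕜 := ℝ)).const_mul (2 * C)
  simp only [mul_one_div, mul_zero] at hlim
  exact ge_of_tendsto' hlim key

variable [DecidableEq G]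

lemma card_image_add_right_sdiff (B : Finset G) (t : G) :
    (B \ B.image (· + t)).card = (B.image (· + t) \ B).card :=
  Finset.card_sdiff_comm (Finset.card_image_of_injective _ (add_left_injective t)).symm

lemma sum_le_sum_add_translate {f : G → ℝ} {C : ℝ} (hC : ∀ x, |f x| ≤ C) (B : Finset G)
    (s t : G) :
    ∑ b ∈ B, f (b + s) ≤
      ∑ b ∈ B, f (b + (s + t)) + 2 * C * ((B.image (· + t) \ B).card : ℝ) := by
  have himage : ∑ b ∈ B, f (b + (s + t)) = ∑ b ∈ B.image (· + t), f (b + s) := by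
    rw [Finset.sum_image fun x _ y _ h => add_left_injective t h]
    exact Finset.sum_congr rfl fun b _ => by congr 1; abel
  have h₁ : ∑ b ∈ B \ B.image (· + t), f (b + s) ≤ (B.image (· + t) \ B).card * C := by
    rw [← card_image_add_right_sdiff, ← nsmul_eq_mul]
    exact Finset.sum_le_card_nsmul _ _ _ fun b _ => (abs_le.1 (hC _)).2
  have h₂ : (B.image (· + t) \ B).card * (-C) ≤ ∑ b ∈ B.image (· + t) \ B, f (b + s) := by
    rw [← nsmul_eq_mul]
    exact Finset.card_nsmul_le_sum _ _ _ fun b _ => (abs_le.1 (hC _)).1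
  have h₃ := Finset.sum_inter_add_sum_sdiff B (B.image (· + t)) fun b => f (b + s)
  have h₄ := Finset.sum_inter_add_sum_sdiff (B.image (· + t)) B fun b => f (b + s)
  rw [Finset.inter_comm] at h₄
  linarith

lemma avg_le_sSup_add {f : G → ℝ} {C : ℝ} (hC : ∀ x, |f x| ≤ C) {n : ℕ} {c : Fin n → ℝ}
    {t : Fin n → G} (hc : ∀ i, 0 ≤ c i) (hsum : ∑ i, c i = 1) {a : ℝ}
    (ha : ∀ x, ∑ i, c i * f (x + t i) ≤ a) {B : Finset G} (hB : B.Nonempty) (s : G) :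
    avg f B s ≤
      a + 2 * C * ∑ i, c i * (((B.image (· + t i) \ B).card : ℝ) / (B.card : ℝ)) := by
  have hcard : (0 : ℝ) < B.card := by exact_mod_cast hB.card_pos
  rw [avg, div_le_iff₀ hcard]
  calc ∑ b ∈ B, f (b + s) = ∑ i, c i * ∑ b ∈ B, f (b + s) := by
        rw [← Finset.sum_mul, hsum, one_mul]
    _ ≤ ∑ i, c i * (∑ b ∈ B, f (b + (s + t i)) +
          2 * C * ((B.image (· + t i) \ B).card : ℝ)) :=
        Finset.sum_le_sum fun i _ =>
          mul_le_mul_of_nonneg_left (sum_le_sum_add_translate hC B s (t i)) (hc i)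
    _ = ∑ b ∈ B, ∑ i, c i * f (b + s + t i) +
          2 * C * ∑ i, c i * ((B.image (· + t i) \ B).card : ℝ) := by
        rw [Finset.sum_comm, Finset.mul_sum, ← Finset.sum_add_distrib]
        refine Finset.sum_congr rfl fun i _ => ?_
        simp only [← Finset.mul_sum, add_assoc]
        ring
    _ ≤ B.card * a + 2 * C * ∑ i, c i * ((B.image (· + t i) \ B).card : ℝ) := by
        gcongr
        rw [← nsmul_eq_mul]
        exact Finset.sum_le_card_nsmul _ _ _ fun b _ => ha _
    _ = (a + 2 * C * ∑ i, c i *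
          (((B.image (· + t i) \ B).card : ℝ) / (B.card : ℝ))) * B.card := by
        simp only [mul_div_assoc', ← Finset.sum_div]
        field_simp

/-- Along a Følner sequence the suprema of the averages converge to the uppermost mean. -/
lemma tendsto_iSup_avg {B : ℕ → Finset G} (hB : ∀ i, (B i).Nonempty)
    (hF : ∀ t : G, Tendsto
      (fun i => ((((B i).image (· + t)) \ B i).card : ℝ) / ((B i).card : ℝ)) atTop (nhds 0))
    {f : G → ℝ} (hf : Bounded f) :
    Tendsto (fun i => ⨆ t : G, avg f (B i) t) atTop (nhds (Mstar f)) := by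
  refine tendsto_order.2 ⟨fun a ha => Eventually.of_forall fun i =>
    ha.trans_le (Mstar_le_of_convexCombTranslates hf (convexCombTranslates_avg f (hB i))),
    fun a ha => ?_⟩
  obtain ⟨g, hg, hlt⟩ := exists_convexCombTranslates_lt f ha
  have hbdd := (hg.bounded hf).bddAbove_range
  obtain ⟨C, hC⟩ := hf
  obtain ⟨n, c, t, hc, hsum, hgx⟩ := hg
  have hlim : Tendsto (fun i => sSup (Set.range g) + 2 * C * ∑ j, c j *
      (((((B i).image (· + t j)) \ B i).card : ℝ) / ((B i).card : ℝ))) atTop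
      (nhds (sSup (Set.range g))) := by
    simpa using ((tendsto_finsetSum Finset.univ fun j _ =>
      (hF (t j)).const_mul (c j)).const_mul (2 * C)).const_add (sSup (Set.range g))
  filter_upwards [hlim.eventually_lt_const hlt] with i hi
  exact (ciSup_le fun s => avg_le_sSup_add hC hc hsum
    (fun x => hgx x ▸ le_csSup hbdd ⟨x, rfl⟩) (hB i) s).trans_lt hi

/-- In an infinite group, any sequence of finite sets has pairwise disjoint translates. -/
lemma exists_pairwise_disjoint_translates [Infinite G] (D : ℕ → Finset G) :
    ∃ s : ℕ → G, Pairwise fun i j =>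
      Disjoint ((D i).image (· + s i)) ((D j).image (· + s j)) := by
  have hpick : ∀ (n : ℕ) (U : Finset G), ∃ s : G, Disjoint U ((D n).image (· + s)) := by
    intro n U
    obtain ⟨s, hs⟩ := Infinite.exists_notMem_finset (U - D n)
    refine ⟨s, Finset.disjoint_left.2 fun x hxU hx => hs ?_⟩
    obtain ⟨d, hd, rfl⟩ := Finset.mem_image.1 hx
    exact Finset.mem_sub.2 ⟨_, hxU, d, hd, by abel⟩
  choose p hp using hpick
  let U : ℕ → Finset G := fun n =>
    Nat.rec ∅ (fun k V => V ∪ (D k).image (· + p k V)) n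
  have hU : ∀ n, U (n + 1) = U n ∪ (D n).image (· + p n (U n)) := fun _ => rfl
  have hmono : Monotone U := monotone_nat_of_le_succ fun n => by
    rw [hU]; exact Finset.subset_union_left
  refine ⟨fun n => p n (U n), (pairwise_disjoint_on _).2 fun i j hij => ?_⟩
  refine Finset.disjoint_of_subset_left ?_ (hp j (U j))
  refine Finset.Subset.trans ?_ (hmono (Nat.succ_le_of_lt hij))
  rw [Nat.succ_eq_add_one, hU]
  exact Finset.subset_union_right

/-- The Følner condition is necessary for convergence of the suprema of averages. -/
lemma tendsto_card_sdiff_div_card [Infinite G] {B : ℕ → Finset G} (hB : ∀ i, (B i).Nonempty)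
    (hconv : ∀ f : G → ℝ, Bounded f →
      Tendsto (fun i => ⨆ t : G, avg f (B i) t) atTop (nhds (Mstar f))) (t : G) :
    Tendsto (fun i => ((((B i).image (· + t)) \ B i).card : ℝ) / ((B i).card : ℝ))
      atTop (nhds 0) := by
  classical
  obtain ⟨s, hs⟩ := exists_pairwise_disjoint_translates fun i => B i ∪ (B i).image (· - t)
  let h : G → ℝ := fun x => if ∃ i, x - s i ∈ B i then 1 else 0
  have hh : Bounded h := ⟨1, fun x => by simp only [h]; split_ifs <;> simp⟩
  have hf : Bounded fun x => h x - h (x - t) := by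
    obtain ⟨C, hC⟩ := hh
    exact Bounded.sub ⟨C, hC⟩ ⟨C, fun x => hC _⟩
  have hval : ∀ i, ∀ b ∈ B i,
      h (b + s i) - h (b + s i - t) = if b ∈ B i \ (B i).image (· + t) then 1 else 0 := by
    intro i b hb
    have h₁ : h (b + s i) = 1 := if_pos ⟨i, by simpa using hb⟩
    have hmem : b ∈ (B i).image (· + t) ↔ ∃ j, b + s i - t - s j ∈ B j := by
      rw [Finset.mem_image]
      constructor
      · rintro ⟨a, ha, rfl⟩
        exact ⟨i, by convert ha using 1; abel⟩
      · rintro ⟨j, hj⟩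
        have hij : i = j := by
          by_contra hne
          refine Finset.disjoint_left.1 (hs hne)
            (Finset.mem_image.2 ⟨b - t, Finset.mem_union_right _
              (Finset.mem_image_of_mem _ hb), rfl⟩)
            (Finset.mem_image.2 ⟨_, Finset.mem_union_left _ hj, by abel⟩)
        subst hij
        exact ⟨_, hj, by abel⟩
    rw [h₁]
    simp only [h, Finset.mem_sdiff, hb, true_and, hmem]
    split_ifs <;> simp
  have havg : ∀ i, avg (fun x => h x - h (x - t)) (B i) (s i) =
      ((((B i).image (· + t)) \ B i).card : ℝ) / ((B i).card : ℝ) := by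
    intro i
    rw [avg, Finset.sum_congr rfl (hval i), Finset.sum_boole, ← card_image_add_right_sdiff]
    congr 3
    ext x
    simp
  have hM := Mstar_sub_translate_nonpos hh t
  have hlim := (hconv _ hf).sub_const (Mstar fun x => h x - h (x - t))
  rw [sub_self] at hlim
  refine squeeze_zero (fun i => by positivity) (fun i => ?_) hlim
  have := le_ciSup ((convexCombTranslates_avg _ (hB i)).bounded hf).bddAbove_range (s i)
  rw [havg] at this
  linarith

/-- In a commutative group, any finite family of translations has approximately invariant
finite sets. -/
lemma exists_approx_invariant {ι : Type*} [Fintype ι] [DecidableEq ι] (g : ι → G) {ε : ℝ}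
    (hε : 0 < ε) :
    ∃ B : Finset G, B.Nonempty ∧
      ∀ j, ((B.image (· + g j) \ B).card : ℝ) / (B.card : ℝ) ≤ ε := by
  let A : ℕ → Finset G := fun k =>
    (Fintype.piFinset fun _ : ι => Finset.range (k + 1)).image fun a => ∑ j, a j • g j
  have hA : ∀ k, (A k).Nonempty := fun k => Finset.Nonempty.image ⟨0, by simp⟩ _
  have hcard : ∀ k, (A k).card ≤ (k + 1) ^ Fintype.card ι := fun k =>
    Finset.card_image_le.trans (by simp [Fintype.card_piFinset])
  have hsub : ∀ k, A k ⊆ A (k + 1) := fun k =>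
    Finset.image_subset_image (Fintype.piFinset_subset _ _ fun _ =>
      Finset.range_mono (by lia))
  have hadd : ∀ k j, (A k).image (· + g j) ⊆ A (k + 1) := by
    intro k j x hx
    simp only [A, Finset.mem_image, exists_exists_and_eq_and, Fintype.mem_piFinset,
      Finset.mem_range] at hx ⊢
    obtain ⟨a, ha, rfl⟩ := hx
    refine ⟨a + Pi.single j 1, fun i => ?_, ?_⟩
    · have := ha i
      rcases eq_or_ne i j with rfl | hij
      · simpa using this
      · simpa [hij] using this.trans (Nat.lt_succ_self _)
    · simp [add_smul, Finset.sum_add_distrib, Pi.single_apply, ite_smul]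
  by_contra! hcon
  have hgrow : ∀ k, (1 + ε) * (A k).card ≤ (A (k + 1)).card := by
    intro k
    obtain ⟨j, hj⟩ := hcon (A k) (hA k)
    rw [lt_div_iff₀ (by exact_mod_cast (hA k).card_pos)] at hj
    have h₁ : ((A k).image (· + g j) \ A k).card ≤ (A (k + 1) \ A k).card :=
      Finset.card_le_card (Finset.sdiff_subset_sdiff (hadd k j) subset_rfl)
    have h₂ := Finset.card_sdiff_add_card_eq_card (hsub k)
    have h₃ : (((A k).image (· + g j) \ A k).card : ℝ) + (A k).card ≤ (A (k + 1)).card := by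
      exact_mod_cast (by lia)
    linarith
  have hexp : ∀ k, (1 + ε) ^ k ≤ ((A k).card : ℝ) := by
    intro k
    induction k with
    | zero => simpa using (hA 0).card_pos
    | succ k ih =>
      rw [pow_succ']
      exact (mul_le_mul_of_nonneg_left ih (by positivity)).trans (hgrow k)
  have hlim := (tendsto_pow_const_div_const_pow_of_one_lt (Fintype.card ι)
    (show 1 < 1 + ε by linarith)).comp (tendsto_add_atTop_nat 1)
  obtain ⟨k, hk⟩ := (hlim.eventually_lt_const (show (0 : ℝ) < (1 + ε)⁻¹ by positivity)).exists
  simp only [Function.comp_apply] at hk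
  rw [div_lt_iff₀ (by positivity), pow_succ' (1 + ε), inv_mul_cancel_left₀ (by positivity)] at hk
  have : ((A k).card : ℝ) ≤ ((k + 1 : ℕ) : ℝ) ^ Fintype.card ι := by exact_mod_cast hcard k
  linarith [hexp k]

lemma exists_folner_seq [Countable G] :
    ∃ B : ℕ → Finset G, (∀ i, (B i).Nonempty) ∧
      ∀ t : G, Tendsto
        (fun i => ((((B i).image (· + t)) \ B i).card : ℝ) / ((B i).card : ℝ))
        atTop (nhds 0) := by
  obtain ⟨e, he⟩ := exists_surjective_nat G
  choose B hB hBε using fun n : ℕ =>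
    exists_approx_invariant (fun j : Fin n => e j) (Nat.one_div_pos_of_nat (α := ℝ) (n := n))
  refine ⟨B, hB, fun t => ?_⟩
  obtain ⟨m, rfl⟩ := he t
  refine squeeze_zero' (Eventually.of_forall fun i => by positivity) ?_
    (tendsto_one_div_add_atTop_nhds_zero_nat (𝕜 := ℝ))
  filter_upwards [eventually_gt_atTop m] with n hn
  exact hBε n ⟨m, hn⟩

lemma countable_of_folner_seq {B : ℕ → Finset G} (hB : ∀ i, (B i).Nonempty)
    (hF : ∀ t : G, Tendsto
      (fun i => ((((B i).image (· + t)) \ B i).card : ℝ) / ((B i).card : ℝ)) atTop (nhds 0)) :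
    Countable G := by
  have hcover : (⋃ i, ((B i - B i : Finset G) : Set G)) = Set.univ := by
    refine Set.eq_univ_of_forall fun t => Set.mem_iUnion.2 ?_
    obtain ⟨i, hi⟩ := ((hF t).eventually_lt_const zero_lt_one).exists
    rw [div_lt_one (by exact_mod_cast (hB i).card_pos), Nat.cast_lt] at hi
    have hnd : ¬ Disjoint ((B i).image (· + t)) (B i) := fun hd => by
      rw [Finset.sdiff_eq_self_of_disjoint hd,
        Finset.card_image_of_injective _ (add_left_injective t)] at hi
      exact hi.false
    obtain ⟨x, hx, hxB⟩ := Finset.not_disjoint_iff.1 hnd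
    obtain ⟨b, hb, rfl⟩ := Finset.mem_image.1 hx
    exact ⟨i, Finset.mem_coe.2 (Finset.mem_sub.2 ⟨_, hxB, b, hb, by abel⟩)⟩
  rw [← Set.countable_univ_iff, ← hcover]
  exact Set.countable_iUnion fun i => Finset.countable_toSet _

end UppermostMean

/-- along a Følner-type sequence `Bᵢ`, `sup_t (f|Bᵢ)(t) → M*(f)` for every
bounded `f`; the Følner condition is necessary for this; and such a sequence exists iff
`G` is countable. -/
theorem stmt14 {G : Type*} [AddCommGroup G] [Infinite G] [DecidableEq G] :
    (∀ B : ℕ → Finset G, (∀ i, (B i).Nonempty) →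
      (∀ t : G, Tendsto
          (fun i => ((((B i).image (· + t)) \ B i).card : ℝ) / ((B i).card : ℝ))
          atTop (nhds 0)) →
      ∀ f : G → ℝ, Bounded f →
        Tendsto (fun i => ⨆ t : G, avg f (B i) t) atTop (nhds (Mstar f))) ∧
    (∀ B : ℕ → Finset G, (∀ i, (B i).Nonempty) →
      (∀ f : G → ℝ, Bounded f →
        Tendsto (fun i => ⨆ t : G, avg f (B i) t) atTop (nhds (Mstar f))) →
      ∀ t : G, Tendsto
          (fun i => ((((B i).image (· + t)) \ B i).card : ℝ) / ((B i).card : ℝ))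
          atTop (nhds 0)) ∧
    ((∃ B : ℕ → Finset G, (∀ i, (B i).Nonempty) ∧
        ∀ t : G, Tendsto
          (fun i => ((((B i).image (· + t)) \ B i).card : ℝ) / ((B i).card : ℝ))
          atTop (nhds 0)) ↔ Countable G) := by
  exact ⟨fun B hB hF f hf => tendsto_iSup_avg hB hF hf,
    fun B hB hconv t => tendsto_card_sdiff_div_card hB hconv t,
    fun ⟨_, hB, hF⟩ => countable_of_folner_seq hB hF, fun _ => exists_folner_seq⟩
end

section
/- Let G be an infinite commutative group and f : G → ℝ a bounded function. Then E(f) = min { sup_x f(x), M*(f⁺) }, where f⁺(x) = max(f(x), 0) is the positive part of f. -/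
open scoped Pointwise BigOperators
open Filter

lemma exists_weights_of_mem_nsmul {G : Type*} [AddCommGroup G] [DecidableEq G] (T : Finset G)
    (n : ℕ) : ∀ x ∈ n • T, ∃ c : T → ℕ, (∀ t, c t ≤ n) ∧ x = ∑ t, c t • (t : G) := by
  induction n with
  | zero =>
    intro x hx
    rw [zero_nsmul, Finset.mem_zero] at hx
    exact ⟨fun _ => 0, by simp, by simp [hx]⟩
  | succ n ih =>
    intro x hx
    rw [succ_nsmul, Finset.mem_add] at hx
    obtain ⟨y, hy, t, ht, rfl⟩ := hx
    obtain ⟨c, hc, rfl⟩ := ih y hy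
    refine ⟨fun s => c s + if s = ⟨t, ht⟩ then 1 else 0, fun s => ?_, ?_⟩
    · have := hc s
      dsimp only
      split_ifs <;> omega
    · simp [add_smul, Finset.sum_add_distrib, ite_smul]

/-- Finite subsets of a commutative group have polynomial growth. -/
lemma card_nsmul_le_succ_pow {G : Type*} [AddCommGroup G] [DecidableEq G] (T : Finset G)
    (n : ℕ) : (n • T).card ≤ (n + 1) ^ T.card := by
  have hsub : n • T ⊆ (Fintype.piFinset fun _ : T => Finset.range (n + 1)).image
      (fun c : T → ℕ => ∑ t : T, c t • (t : G)) := by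
    intro x hx
    obtain ⟨c, hc, rfl⟩ := exists_weights_of_mem_nsmul T n x hx
    refine Finset.mem_image.2 ⟨c, Fintype.mem_piFinset.2 fun t => ?_, rfl⟩
    exact Finset.mem_range.2 (Nat.lt_succ_of_le (hc t))
  refine (Finset.card_le_card hsub).trans (Finset.card_image_le.trans ?_)
  simp

/-- A commutative group has Følner sets. -/
lemma exists_card_add_le {G : Type*} [AddCommGroup G] [DecidableEq G] {T : Finset G}
    (hT : T.Nonempty) {ε : ℝ} (hε : 0 < ε) :
    ∃ S : Finset G, S.Nonempty ∧ ((S + T).card : ℝ) ≤ (1 + ε) * S.card := by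
  by_contra! h
  have hgrow : ∀ n : ℕ, (1 + ε) ^ n ≤ ((n • T).card : ℝ) := by
    intro n
    induction n with
    | zero => simp
    | succ n ih =>
      have := h (n • T) (hT.nsmul)
      rw [succ_nsmul, pow_succ']
      exact (mul_le_mul_of_nonneg_left ih (by positivity)).trans this.le
  have hlim := ((tendsto_pow_const_div_const_pow_of_one_lt T.card
    (show 1 < 1 + ε by linarith)).comp (tendsto_add_atTop_nat 1)).eventually
      (gt_mem_nhds (show (0 : ℝ) < (1 + ε)⁻¹ by positivity))
  obtain ⟨n, hn⟩ := hlim.exists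
  have hpoly : ((n • T).card : ℝ) ≤ ((n : ℝ) + 1) ^ T.card := by
    exact_mod_cast card_nsmul_le_succ_pow T n
  simp only [Function.comp_apply, Nat.cast_add, Nat.cast_one] at hn
  rw [div_lt_iff₀ (by positivity), pow_succ', inv_mul_cancel_left₀ (by positivity)] at hn
  linarith [hgrow n]

lemma Bounded.bddAbove {G : Type*} {f : G → ℝ} (hf : Bounded f) : BddAbove (Set.range f) := by
  obtain ⟨C, hC⟩ := hf
  exact ⟨C, by rintro _ ⟨x, rfl⟩; exact (abs_le.1 (hC x)).2⟩

lemma Bounded.posPart {G : Type*} {f : G → ℝ} (hf : Bounded f) :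
    Bounded (fun x => max (f x) 0) := by
  obtain ⟨C, hC⟩ := hf
  refine ⟨C, fun x => ?_⟩
  rw [abs_of_nonneg (le_max_right _ _)]
  exact max_le ((le_abs_self _).trans (hC x)) ((abs_nonneg _).trans (hC x))

lemma ConvexCombTranslates.bounded_s15 {G : Type*} [AddCommGroup G] {f g : G → ℝ} {C : ℝ}
    (hC : ∀ x, |f x| ≤ C) (hg : ConvexCombTranslates f g) : ∀ x, |g x| ≤ C := by
  obtain ⟨n, c, t, hc, hsum, hg⟩ := hg
  intro x
  rw [hg]
  calc |∑ i, c i * f (x + t i)| ≤ ∑ i, |c i * f (x + t i)| := Finset.abs_sum_le_sum_abs _ _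
    _ ≤ ∑ i, c i * C := Finset.sum_le_sum fun i _ => by
        rw [abs_mul, abs_of_nonneg (hc i)]
        exact mul_le_mul_of_nonneg_left (hC _) (hc i)
    _ = C := by rw [← Finset.sum_mul, hsum, one_mul]

lemma Mstar_le {G : Type*} [AddCommGroup G] {f g : G → ℝ} (hf : Bounded f)
    (hg : ConvexCombTranslates f g) {a : ℝ} (ha : ∀ x, g x ≤ a) : Mstar f ≤ a := by
  obtain ⟨C, hC⟩ := hf
  have hbelow : BddBelow {a : ℝ | ∃ g : G → ℝ, ConvexCombTranslates f g ∧
      a = sSup (Set.range g)} := by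
    refine ⟨-C, ?_⟩
    rintro _ ⟨h, hh, rfl⟩
    have hb := hh.bounded_s15 hC
    exact (abs_le.1 (hb 0)).1.trans (le_csSup (Bounded.bddAbove ⟨C, hb⟩) ⟨0, rfl⟩)
  refine (csInf_le hbelow ⟨g, hg, rfl⟩).trans (csSup_le (Set.range_nonempty g) ?_)
  rintro _ ⟨x, rfl⟩
  exact ha x

lemma le_Mstar {G : Type*} [AddCommGroup G] {f : G → ℝ} (hf : Bounded f) {a : ℝ}
    (h : ∀ g, ConvexCombTranslates f g → ∀ m, (∀ x, g x ≤ m) → a ≤ m) : a ≤ Mstar f := by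
  obtain ⟨C, hC⟩ := hf
  refine le_csInf ⟨_, f, ⟨1, fun _ => 1, fun _ => 0, by simp, by simp, by simp⟩, rfl⟩ ?_
  rintro _ ⟨g, hg, rfl⟩
  exact h g hg _ fun x => le_csSup (Bounded.bddAbove ⟨C, hg.bounded_s15 hC⟩) ⟨x, rfl⟩

/-- Averaging over the translates of a Følner set bounds the uppermost mean. -/
lemma Mstar_le_of_sum_le {G : Type*} [AddCommGroup G] [DecidableEq G] {f : G → ℝ}
    (hf : Bounded f) {T : Finset G} (hT : T.Nonempty) {e : ℝ} (he : 0 ≤ e)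
    (h : ∀ B : Finset G, ∑ b ∈ B, f b ≤ e * (B + T).card) : Mstar f ≤ e := by
  refine le_of_forall_pos_le_add fun δ hδ => ?_
  obtain ⟨S, hS, hST⟩ := exists_card_add_le hT (show 0 < δ / (e + 1) by positivity)
  have hS0 : (0 : ℝ) < S.card := by exact_mod_cast hS.card_pos
  have hg : ConvexCombTranslates f (fun x => ∑ i, (S.card : ℝ)⁻¹ *
      f (x + (S.equivFin.symm i : G))) := by
    refine ⟨S.card, fun _ => (S.card : ℝ)⁻¹, fun i => (S.equivFin.symm i : G), ?_, ?_, ?_⟩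
    · intro i; positivity
    · simp [hS0.ne']
    · intro x; rfl
  refine Mstar_le hf hg fun x => ?_
  have hsum : ∑ i, f (x + (S.equivFin.symm i : G)) = ∑ b ∈ {x} + S, f b := by
    rw [Equiv.sum_comp S.equivFin.symm (fun s : S => f (x + s)),
      Finset.sum_coe_sort S (fun s => f (x + s)), Finset.singleton_add,
      ← Finset.image_vadd, Finset.sum_image (fun a _ b _ hab => vadd_left_cancel x hab)]
    rfl
  have hcard : (({x} + S + T : Finset G).card : ℝ) = (S + T).card := by
    rw [add_assoc, Finset.card_singleton_add]
  rw [← Finset.mul_sum, hsum, inv_mul_le_iff₀ hS0]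
  calc ∑ b ∈ {x} + S, f b ≤ e * (S + T).card := by rw [← hcard]; exact h _
    _ ≤ e * ((1 + δ / (e + 1)) * S.card) := mul_le_mul_of_nonneg_left hST he
    _ = S.card * (e + e / (e + 1) * δ) := by ring
    _ ≤ S.card * (e + δ) := by
        have : e / (e + 1) ≤ 1 := (div_le_one (by positivity)).2 (by linarith)
        have := mul_le_mul_of_nonneg_right this hδ.le
        gcongr
        linarith

/-- If a convex combination of translates of `f ≥ 0` is at most `m`, then some finite set `T`
spreads the mass of `f` on any finite set `B` over `B + T` with density at most `m`. -/
lemma exists_sum_le_of_convexCombTranslates {G : Type*} [AddCommGroup G] [DecidableEq G]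
    {f g : G → ℝ} (hf : ∀ x, 0 ≤ f x) (hg : ConvexCombTranslates f g) {m : ℝ}
    (hm : ∀ x, g x ≤ m) :
    ∃ T : Finset G, T.Nonempty ∧ ∀ B : Finset G, ∑ b ∈ B, f b ≤ m * (B + T).card := by
  obtain ⟨n, c, t, hc, hsum, hg⟩ := hg
  have : Nonempty (Fin n) := by
    by_contra h
    rw [not_nonempty_iff] at h
    simp at hsum
  refine ⟨Finset.univ.image fun i => -t i, Finset.univ_nonempty.image _, fun B => ?_⟩
  set D := B + Finset.univ.image fun i => -t i
  have hle : ∀ i, ∑ b ∈ B, f b ≤ ∑ x ∈ D, f (x + t i) := by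
    intro i
    have hsub : B.image (fun b => b - t i) ⊆ D := by
      intro y hy
      obtain ⟨b, hb, rfl⟩ := Finset.mem_image.1 hy
      rw [sub_eq_add_neg]
      exact Finset.add_mem_add hb (Finset.mem_image_of_mem _ (Finset.mem_univ i))
    refine le_trans (le_of_eq ?_) (Finset.sum_le_sum_of_subset_of_nonneg hsub fun x _ _ => hf _)
    rw [Finset.sum_image (fun a _ b _ hab => sub_left_injective hab)]
    simp
  calc ∑ b ∈ B, f b = ∑ i, c i * ∑ b ∈ B, f b := by rw [← Finset.sum_mul, hsum, one_mul]
    _ ≤ ∑ i, c i * ∑ x ∈ D, f (x + t i) :=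
        Finset.sum_le_sum fun i _ => mul_le_mul_of_nonneg_left (hle i) (hc i)
    _ = ∑ x ∈ D, g x := by
        simp_rw [hg, Finset.mul_sum]
        exact Finset.sum_comm
    _ ≤ m * D.card := by
        rw [mul_comm, ← nsmul_eq_mul]
        exact Finset.sum_le_card_nsmul _ _ _ fun x _ => hm x

lemma bddAbove_expansion {G : Type*} [AddCommGroup G] [DecidableEq G] {f : G → ℝ}
    (hf : Bounded f) {T : Finset G} (hT : T.Nonempty) :
    BddAbove (Set.range fun B : {B : Finset G // B.Nonempty} =>
      (∑ b ∈ B.1, f b) / ((B.1 + T).card : ℝ)) := by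
  obtain ⟨C, hC⟩ := hf
  refine ⟨C, ?_⟩
  rintro _ ⟨B, rfl⟩
  have hpos : (0 : ℝ) < (B.1 + T).card := by exact_mod_cast (B.2.add hT).card_pos
  have hC0 : 0 ≤ C := (abs_nonneg _).trans (hC 0)
  have hcard : (B.1.card : ℝ) ≤ (B.1 + T).card := by
    exact_mod_cast Finset.card_le_card_add_right hT
  dsimp only
  rw [div_le_iff₀ hpos]
  have := Finset.sum_le_card_nsmul B.1 f C fun x _ => (abs_le.1 (hC x)).2
  rw [nsmul_eq_mul, mul_comm] at this
  exact this.trans (mul_le_mul_of_nonneg_left hcard hC0)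

lemma Epm_le {G : Type*} [AddCommGroup G] [DecidableEq G] {f : G → ℝ} (hf : Bounded f)
    {T : Finset G} (hT : T.Nonempty) {m : ℝ}
    (h : ∀ B : Finset G, ∑ b ∈ B, f b ≤ m * (B + T).card) : Epm f ≤ m := by
  have : Nonempty {B : Finset G // B.Nonempty} := ⟨⟨{0}, Finset.singleton_nonempty 0⟩⟩
  have hbelow : BddBelow (Set.range fun T : {T : Finset G // T.Nonempty} =>
      ⨆ B : {B : Finset G // B.Nonempty}, (∑ b ∈ B.1, f b) / ((B.1 + T.1).card : ℝ)) := by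
    obtain ⟨C, hC⟩ := id hf
    refine ⟨-C, ?_⟩
    rintro _ ⟨U, rfl⟩
    refine le_trans ?_ (le_ciSup (bddAbove_expansion hf U.2) ⟨{0}, Finset.singleton_nonempty 0⟩)
    have hpos : (1 : ℝ) ≤ ({0} + U.1 : Finset G).card := by
      exact_mod_cast ((Finset.singleton_nonempty 0).add U.2).card_pos
    have hC0 : 0 ≤ C := (abs_nonneg _).trans (hC 0)
    have h0 := (abs_le.1 (hC 0)).1
    rw [le_div_iff₀ (by linarith), Finset.sum_singleton]
    nlinarith
  refine (ciInf_le hbelow ⟨T, hT⟩).trans (ciSup_le fun B => ?_)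
  rw [div_le_iff₀ (by exact_mod_cast (B.2.add hT).card_pos)]
  exact h B

lemma le_Epm {G : Type*} [AddCommGroup G] [DecidableEq G] {f : G → ℝ} (hf : Bounded f) {a : ℝ}
    (h : ∀ T : Finset G, T.Nonempty → ∀ e : ℝ,
      (∀ B : Finset G, B.Nonempty → ∑ b ∈ B, f b ≤ e * (B + T).card) → a ≤ e) : a ≤ Epm f := by
  have : Nonempty {T : Finset G // T.Nonempty} := ⟨⟨{0}, Finset.singleton_nonempty 0⟩⟩
  refine le_ciInf fun T => h T.1 T.2 _ fun B hB => ?_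
  rw [← div_le_iff₀ (by exact_mod_cast (hB.add T.2).card_pos)]
  exact le_ciSup (bddAbove_expansion hf T.2) ⟨B, hB⟩

/-- `E(f) = min { sup f, M*(f⁺) }` for every bounded `f`. -/
theorem stmt15 {G : Type*} [AddCommGroup G] [Infinite G] [DecidableEq G]
    (f : G → ℝ) (hf : Bounded f) :
    Epm f = min (sSup (Set.range f)) (Mstar (fun x => max (f x) 0)) := by
  refine le_antisymm (le_min ?_ ?_) (le_Epm hf fun T hT e he => ?_)
  · refine Epm_le hf (Finset.singleton_nonempty 0) fun B => ?_
    rw [Finset.card_add_singleton, mul_comm, ← nsmul_eq_mul]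
    simpa using Finset.sum_le_card_nsmul B f _ fun x _ => le_csSup hf.bddAbove ⟨x, rfl⟩
  · refine le_Mstar hf.posPart fun g hg m hm => ?_
    obtain ⟨T, hT, h⟩ :=
      exists_sum_le_of_convexCombTranslates (fun x => le_max_right (f x) 0) hg hm
    exact Epm_le hf hT fun B => (Finset.sum_le_sum fun b _ => le_max_left _ _).trans (h B)
  · have hT1 : (1 : ℝ) ≤ T.card := by exact_mod_cast hT.card_pos
    have hsingle : ∀ x, f x ≤ e * T.card := by
      intro x
      have := he {x} (Finset.singleton_nonempty x)
      rwa [Finset.sum_singleton, Finset.card_singleton_add] at this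
    by_cases hpos : ∃ x, 0 < f x
    · obtain ⟨x₀, hx₀⟩ := hpos
      have he0 : 0 ≤ e := by
        by_contra! h
        nlinarith [hsingle x₀]
      refine (min_le_right _ _).trans (Mstar_le_of_sum_le hf.posPart hT he0 fun B => ?_)
      have hfilter : ∑ b ∈ B, max (f b) 0 = ∑ b ∈ B with 0 < f b, f b := by
        rw [Finset.sum_filter]
        refine Finset.sum_congr rfl fun b _ => ?_
        split_ifs with hb
        · exact max_eq_left hb.le
        · exact max_eq_right (not_lt.1 hb)
      rw [hfilter]
      rcases (B.filter fun b => 0 < f b).eq_empty_or_nonempty with h0 | hne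
      · rw [h0, Finset.sum_empty]
        positivity
      · refine (he _ hne).trans (mul_le_mul_of_nonneg_left ?_ he0)
        exact_mod_cast Finset.card_le_card (Finset.add_subset_add_right (Finset.filter_subset _ _))
    · push Not at hpos
      refine (min_le_left _ _).trans (csSup_le (Set.range_nonempty f) ?_)
      rintro _ ⟨x, rfl⟩
      by_contra! h
      nlinarith [hsingle x, hpos x]
end

section
/- Let G be an infinite commutative group. For every finite nonempty subset B ⊆ G and every ε > 0, there exists a tile Y ⊆ G (a finite nonempty set for which there exists Z ⊆ G such that the translates Y + z, z ∈ Z, are pairwise disjoint and cover G) satisfying |B + Y| < (1 + ε)·|Y|. -/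
open scoped Pointwise BigOperators
open Filter

theorem isTile_of_exists_unique_add {G : Type*} [AddCommGroup G] {Y : Finset G} (hY : Y.Nonempty)
    (Z : Set G) (hex : ∀ x, ∃ y ∈ Y, ∃ z ∈ Z, y + z = x)
    (huniq : ∀ y ∈ Y, ∀ z ∈ Z, ∀ y' ∈ Y, ∀ z' ∈ Z, y + z = y' + z' → y = y') :
    IsTile Y := by
  refine ⟨hY, Z, fun x => ?_⟩
  obtain ⟨y, hy, z, hz, rfl⟩ := hex x
  refine ⟨(⟨y, hy⟩, ⟨z, hz⟩), rfl, ?_⟩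
  rintro ⟨⟨y', hy'⟩, ⟨z', hz'⟩⟩ h
  obtain rfl := huniq y' hy' z' hz' y hy z hz h
  obtain rfl := add_left_cancel h
  rfl

theorem IsTile.exists_unique_add {G : Type*} [AddCommGroup G] {Y : Finset G} (hY : IsTile Y) :
    ∃ Z : Set G, (∀ x, ∃ y ∈ Y, ∃ z ∈ Z, y + z = x) ∧
      ∀ y ∈ Y, ∀ z ∈ Z, ∀ y' ∈ Y, ∀ z' ∈ Z, y + z = y' + z' → y = y' := by
  obtain ⟨-, Z, hZ⟩ := hY
  refine ⟨Z, fun x => ?_, fun y hy z hz y' hy' z' hz' h => ?_⟩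
  · obtain ⟨p, hp, -⟩ := hZ x
    exact ⟨p.1, p.1.2, p.2, p.2.2, hp⟩
  · have := (hZ (y' + z')).unique (y₁ := (⟨y, hy⟩, ⟨z, hz⟩)) (y₂ := (⟨y', hy'⟩, ⟨z', hz'⟩)) h rfl
    exact congrArg (fun p => (p.1 : G)) this

/-- The image of a tile under an injective homomorphism is a tile: combine the complement of the
tile with a transversal of the range. -/
theorem IsTile.image_of_injective {H G : Type*} [AddCommGroup H] [AddCommGroup G] [DecidableEq G]
    (f : H →+ G) (hf : Function.Injective f) {Y : Finset H} (hY : IsTile Y) :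
    IsTile (Y.image f) := by
  obtain ⟨Z, hex, huniq⟩ := hY.exists_unique_add
  refine isTile_of_exists_unique_add (hY.1.image f)
    {x | ∃ z ∈ Z, ∃ q : G ⧸ f.range, x = f z + q.out} (fun x => ?_) ?_
  · have hx : x - (QuotientAddGroup.mk x : G ⧸ f.range).out ∈ f.range := by
      rw [← QuotientAddGroup.eq_iff_sub_mem, QuotientAddGroup.out_eq']
    obtain ⟨h, hh⟩ := hx
    obtain ⟨y, hy, z, hz, rfl⟩ := hex h
    refine ⟨f y, Finset.mem_image_of_mem f hy, _, ⟨z, hz, QuotientAddGroup.mk x, rfl⟩, ?_⟩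
    rw [← add_assoc, ← map_add, hh, sub_add_cancel]
  · simp only [Finset.mem_image]
    rintro _ ⟨y, hy, rfl⟩ _ ⟨z, hz, q, rfl⟩ _ ⟨y', hy', rfl⟩ _ ⟨z', hz', q', rfl⟩ h
    rw [← add_assoc, ← add_assoc, ← map_add, ← map_add] at h
    obtain rfl : q = q' := by
      rw [← QuotientAddGroup.out_eq' q, ← QuotientAddGroup.out_eq' q',
        QuotientAddGroup.eq_iff_sub_mem]
      exact ⟨(y' + z') - (y + z), by rw [map_sub, sub_eq_sub_iff_add_eq_add, ← h, add_comm]⟩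
    rw [huniq y hy z hz y' hy' z' hz' (hf (add_right_cancel h))]

theorem isTile_box_product {n : ℕ} {F : Type*} [AddCommGroup F] [Fintype F] {N : ℕ} (hN : 0 < N) :
    IsTile ((Fintype.piFinset fun _ : Fin n => Finset.Ico (0 : ℤ) N) ×ˢ (Finset.univ : Finset F)) := by
  have hN' : (0 : ℤ) < N := by exact_mod_cast hN
  refine isTile_of_exists_unique_add ⟨(0, 0), by simp [hN]⟩
    {x | ∃ v : Fin n → ℤ, x = ((fun i => N * v i), 0)} ?_ ?_
  · rintro ⟨u, t⟩
    refine ⟨(fun i => u i % N, t), ?_, _, ⟨fun i => u i / N, rfl⟩, ?_⟩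
    · simp [Int.emod_nonneg _ hN'.ne', Int.emod_lt_of_pos _ hN']
    · ext i <;> simp [Int.emod_add_mul_ediv]
  · rintro ⟨y, s⟩ hy _ ⟨v, rfl⟩ ⟨y', s'⟩ hy' _ ⟨v', rfl⟩ h
    simp only [Finset.mem_product, Fintype.mem_piFinset, Finset.mem_Ico, Finset.mem_univ,
      and_true] at hy hy'
    simp only [Prod.mk_add_mk, add_zero, Prod.mk.injEq] at h
    refine Prod.ext (funext fun i => ?_) h.2
    have hi : y i + N * v i = y' i + N * v' i := congrFun h.1 i
    have hm := congrArg (· % (N : ℤ)) hi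
    simpa [Int.emod_eq_of_lt (hy i).1 (hy i).2, Int.emod_eq_of_lt (hy' i).1 (hy' i).2] using hm

theorem exists_pow_add_lt (n k : ℕ) {ε : ℝ} (hε : 0 < ε) :
    ∃ N : ℕ, 0 < N ∧ ((N + k : ℕ) : ℝ) ^ n < (1 + ε) * (N : ℝ) ^ n := by
  have hlim : Tendsto (fun N : ℕ => (1 + (k : ℝ) / (N : ℝ)) ^ n) atTop (nhds 1) := by
    simpa using ((tendsto_const_div_atTop_nhds_zero_nat (k : ℝ)).const_add 1).pow n
  obtain ⟨N, hlt, hN⟩ :=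
    ((hlim.eventually_lt_const (lt_add_of_pos_right 1 hε)).and (eventually_gt_atTop 0)).exists
  have hN' : (0 : ℝ) < N := by exact_mod_cast hN
  refine ⟨N, hN, ?_⟩
  calc ((N + k : ℕ) : ℝ) ^ n = (1 + (k : ℝ) / (N : ℝ)) ^ n * (N : ℝ) ^ n := by
        rw [← mul_pow]; push_cast; field_simp
    _ < _ := by gcongr

theorem exists_isTile_card_add_lt_int_prod_finite {n : ℕ} {F : Type*} [AddCommGroup F] [Finite F]
    [DecidableEq ((Fin n → ℤ) × F)] (B : Finset ((Fin n → ℤ) × F)) {ε : ℝ} (hε : 0 < ε) :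
    ∃ Y : Finset ((Fin n → ℤ) × F),
      IsTile Y ∧ ((B + Y).card : ℝ) < (1 + ε) * (Y.card : ℝ) := by
  have := Fintype.ofFinite F
  obtain ⟨K, hK⟩ : ∃ K : ℕ, ∀ b ∈ B, ∀ i, |b.1 i| ≤ K := by
    refine ⟨B.sup fun b => Finset.univ.sup fun i => (b.1 i).natAbs, fun b hb i => ?_⟩
    rw [Int.abs_eq_natAbs]
    exact_mod_cast (Finset.le_sup (f := fun i => (b.1 i).natAbs) (Finset.mem_univ i)).trans
      (Finset.le_sup (f := fun b => Finset.univ.sup fun i => (b.1 i).natAbs) hb)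
  obtain ⟨N, hN, hlt⟩ := exists_pow_add_lt n (2 * K) hε
  refine ⟨_, isTile_box_product hN, ?_⟩
  have hsub : B + (Fintype.piFinset fun _ : Fin n => Finset.Ico (0 : ℤ) N) ×ˢ
      (Finset.univ : Finset F) ⊆ (Fintype.piFinset fun _ : Fin n =>
        Finset.Ico (-K : ℤ) (N + K)) ×ˢ (Finset.univ : Finset F) := by
    intro x hx
    obtain ⟨b, hb, y, hy, rfl⟩ := Finset.mem_add.1 hx
    simp only [Finset.mem_product, Fintype.mem_piFinset, Finset.mem_Ico, Finset.mem_univ,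
      and_true] at hy ⊢
    intro i
    have h₁ := abs_le.1 (hK b hb i)
    have h₂ := hy i
    simp only [Prod.fst_add, Pi.add_apply]
    omega
  have hF : (0 : ℝ) < Fintype.card F := by exact_mod_cast Fintype.card_pos
  have hcard : (N + K - -K : ℤ).toNat = N + 2 * K := by omega
  calc _ ≤ ((N + 2 * K : ℕ) : ℝ) ^ n * Fintype.card F := by
        refine (Nat.cast_le.2 (Finset.card_le_card hsub)).trans_eq ?_
        simp only [Finset.card_product, Fintype.card_piFinset, Int.card_Ico, hcard,
          Finset.prod_const, Finset.card_univ, Fintype.card_fin, Nat.cast_mul, Nat.cast_pow]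
    _ < (1 + ε) * (N : ℝ) ^ n * Fintype.card F := by gcongr
    _ = _ := by simp [mul_assoc]

/-- A finitely generated commutative group is the product of some `ℤⁿ` and a finite group. -/
theorem exists_addEquiv_int_prod_finite (H : Type*) [AddCommGroup H] [AddGroup.FG H] :
    ∃ (n : ℕ) (F : Type) (_ : AddCommGroup F) (_ : Finite F), Nonempty (((Fin n → ℤ) × F) ≃+ H) := by
  classical
  obtain ⟨n, ι, _, p, hp, e, ⟨φ⟩⟩ := AddCommGroup.equiv_free_prod_directSum_zmod H
  have : ∀ i, NeZero (p i ^ e i) := fun i => ⟨pow_ne_zero _ (hp i).ne_zero⟩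
  let ψ := DirectSum.addEquivProd fun i => ZMod (p i ^ e i)
  refine ⟨n, ∀ i, ZMod (p i ^ e i), inferInstance, inferInstance, ⟨?_⟩⟩
  exact ((Finsupp.linearEquivFunOnFinite ℤ ℤ (Fin n)).toAddEquiv.symm.prodCongr ψ.symm).trans φ.symm

/-- for every finite nonempty `B ⊆ G` and `ε > 0` there is a tile `Y` with
`|B + Y| < (1 + ε) |Y|`. -/
theorem stmt18 {G : Type*} [AddCommGroup G] [Infinite G] [DecidableEq G]
    (B : Finset G) (hB : B.Nonempty) (ε : ℝ) (hε : 0 < ε) :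
    ∃ Y : Finset G, IsTile Y ∧ ((B + Y).card : ℝ) < (1 + ε) * (Y.card : ℝ) := by
  let H := AddSubgroup.closure (B : Set G)
  have : AddGroup.FG H := AddGroup.closure_finset_fg B
  obtain ⟨n, F, _, _, ⟨φ⟩⟩ := exists_addEquiv_int_prod_finite H
  classical
  let f : ((Fin n → ℤ) × F) →+ G := H.subtype.comp φ.toAddMonoidHom
  have hf : Function.Injective f := H.subtype_injective.comp φ.injective
  obtain ⟨B', hB'⟩ : ∃ B' : Finset ((Fin n → ℤ) × F), B'.image f = B := by
    have hBf : (B : Set G) ⊆ f '' Set.univ := fun b hb =>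
      ⟨φ.symm ⟨b, AddSubgroup.subset_closure hb⟩, trivial, by simp [f]⟩
    obtain ⟨B', -, hB'⟩ := Finset.subset_set_image_iff.1 hBf
    exact ⟨B', hB'⟩
  obtain ⟨Y, hY, hlt⟩ := exists_isTile_card_add_lt_int_prod_finite B' hε
  refine ⟨Y.image f, hY.image_of_injective f hf, ?_⟩
  rwa [← hB', ← Finset.image_add, Finset.card_image_of_injective _ hf,
    Finset.card_image_of_injective _ hf]
end
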